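/- (Geometric form of the determinant solution for the parallel-update TASEP.) For all t ∈ ℕ, every initial configuration X⁰ and every configuration X of P particles: P_t(X) = (1−v)^{n(X)}·det[F̃_{i−j}(x_i − x⁰_j | t)]_{i,j=1,…,P}, where n(X) := #{i ∈ {1,…,P−1} : x_{i+1} = x_i + 1} is the number of pairs of neighboring particles in the final configuration X. -/

import Mathlib

open Finset

namespace TASEP

attribute [local instance] Classical.propDecidable

noncomputable section

/-- Generalized binomial coefficient `C(n,k) = n(n-1)⋯(n-k+1)/k!` for `n : ℤ`, `k : ℕ`. -/
def C (n : ℤ) (k : ℕ) : ℝ :=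
  (∏ i ∈ Finset.range k, ((n : ℝ) - (i : ℝ))) / (k.factorial : ℝ)

/-- `λ = v/(1-v)`. -/
def lam (v : ℝ) : ℝ := v / (1 - v)

/-- The matrix element `f(a,b,t)` of the determinant solution of the parallel TASEP. -/
def f (v : ℝ) (a b : ℤ) (t : ℕ) : ℝ :=
  if 1 ≤ a then
    (1 - v) ^ t * (-1 : ℝ) ^ a *
      ∑' k : ℕ, if 0 ≤ b + (k : ℤ) then
        C ((t : ℤ) + a) (b + (k : ℤ)).toNat * C (a + (k : ℤ) - 1) k *
          lam v ^ (b + (k : ℤ)).toNat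
      else 0
  else
    (1 - v) ^ t * (-1 : ℝ) ^ a *
      ∑' j : ℕ, if (j : ℤ) ≤ -a ∧ 0 ≤ b + (j : ℤ) then
        (-1 : ℝ) ^ j * C (-a) j * C ((t : ℤ) + a) (b + (j : ℤ)).toNat *
          lam v ^ (b + (j : ℤ)).toNat
      else 0

/-- Number of pairs of neighboring particles (occupied neighboring sites) in `x`. -/
def nPairs {P : ℕ} (x : Fin P → ℤ) : ℕ :=
  (Finset.univ.filter fun p : Fin P × Fin P =>
    ((p.2 : ℕ) = (p.1 : ℕ) + 1) ∧ x p.2 = x p.1 + 1).card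

/-- Number of clusters `N_c(x) = P - nPairs x`. -/
def Nc {P : ℕ} (x : Fin P → ℤ) : ℕ := P - nPairs x

/-- The matrix `F(X,Y,t)` with entries `f(i-j, x_i - y_j, t)`. -/
def Fmat (v : ℝ) {P : ℕ} (x y : Fin P → ℤ) (t : ℕ) : Matrix (Fin P) (Fin P) ℝ :=
  Matrix.of fun i j => f v ((i : ℤ) - (j : ℤ)) (x i - y j) t

/-- One-step transition probability of the parallel-update TASEP. -/
def Tstep (v : ℝ) {P : ℕ} (x x' : Fin P → ℤ) : ℝ :=
  ∏ i : Fin P,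
    if x i = x' i + 1 ∧ (∀ j : Fin P, (j : ℕ) = (i : ℕ) + 1 → x' i + 1 < x' j) then v
    else if x i = x' i ∧ (∀ j : Fin P, (j : ℕ) = (i : ℕ) + 1 → x' i + 1 < x' j) then 1 - v
    else if x i = x' i ∧ (∃ j : Fin P, (j : ℕ) = (i : ℕ) + 1 ∧ x' j = x' i + 1) then 1
    else 0

/-- Transformed transition probability `T₀(X,X') = (1-v)^(N_c(X)-N_c(X')) T(X,X')`. -/
def T0 (v : ℝ) {P : ℕ} (x x' : Fin P → ℤ) : ℝ :=
  (1 - v) ^ ((Nc x : ℤ) - (Nc x' : ℤ)) * Tstep v x x'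

/-- `shiftBy x k` subtracts `1` from the coordinates selected by `k`. -/
def shiftBy {P : ℕ} (x : Fin P → ℤ) (k : Fin P → Bool) : Fin P → ℤ :=
  fun i => x i - if k i then 1 else 0

/-- `t`-step probability of the parallel-update TASEP started from `x0`. -/
def Pt (v : ℝ) {P : ℕ} (x0 : Fin P → ℤ) : ℕ → (Fin P → ℤ) → ℝ
  | 0 => fun x => if x = x0 then 1 else 0
  | t + 1 => fun x => ∑ k : Fin P → Bool,
      if StrictMono (shiftBy x k) then
        Tstep v x (shiftBy x k) * Pt v x0 t (shiftBy x k)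
      else 0

/-- One-particle weight `F₀(x|t)`. -/
def F0 (v : ℝ) (x : ℤ) (t : ℕ) : ℝ :=
  if 0 ≤ x ∧ x ≤ (t : ℤ) then (t.choose x.toNat : ℝ) * v ^ x.toNat * (1 - v) ^ (t - x.toNat)
  else 0

/-- Schütz's functions `F_m(N|t)` for the backward sequential update. -/
def Fm (v : ℝ) (m : ℤ) (N : ℤ) (t : ℕ) : ℝ :=
  if 0 < m then
    ∑' k : ℕ, ((k + m.toNat - 1).choose (m.toNat - 1) : ℝ) * F0 v (N + (k : ℤ)) t
  else if m = 0 then F0 v N t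
  else
    ∑ k ∈ Finset.range (m.natAbs + 1),
      (-1 : ℝ) ^ k * (m.natAbs.choose k : ℝ) * F0 v (N + (k : ℤ)) t

/-- The functions `F̃_m(N|t)` for the parallel update. -/
def Ftil (v : ℝ) (m : ℤ) (N : ℤ) (t : ℕ) : ℝ :=
  if 0 < m then
    ∑ n ∈ Finset.range (m.toNat + 1),
      ∑' k : ℤ, if -(n : ℤ) ≤ k then
        (m.toNat.choose n : ℝ) * ((m + (n : ℤ) + k - 1).toNat.choose ((n : ℤ) + k).toNat : ℝ) *
          lam v ^ n * F0 v (N + k) t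
      else 0
  else if m = 0 then F0 v N t
  else
    ∑ n ∈ Finset.range (m.natAbs + 1),
      ∑' k : ℤ, if -(n : ℤ) ≤ k then
        (-1 : ℝ) ^ n * (m.natAbs.choose n : ℝ) *
          (((m.natAbs : ℤ) + (n : ℤ) + k - 1).toNat.choose ((n : ℤ) + k).toNat : ℝ) *
          (-(lam v)) ^ ((n : ℤ) + k).toNat * F0 v (N - k) t
      else 0

/-- One-step transition probability of the TASEP with backward sequential update. -/
def TBw (v : ℝ) {P : ℕ} (x x' : Fin P → ℤ) : ℝ :=
  ∏ i : Fin P,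
    if h : (i : ℕ) + 1 < P then
      if x' i + 1 < x' ⟨(i : ℕ) + 1, h⟩ ∨
          (x' ⟨(i : ℕ) + 1, h⟩ = x' i + 1 ∧ x ⟨(i : ℕ) + 1, h⟩ = x' ⟨(i : ℕ) + 1, h⟩ + 1) then
        (if x i = x' i + 1 then v else if x i = x' i then 1 - v else 0)
      else if x' ⟨(i : ℕ) + 1, h⟩ = x' i + 1 ∧ x ⟨(i : ℕ) + 1, h⟩ = x' ⟨(i : ℕ) + 1, h⟩ then
        (if x i = x' i then 1 else 0)
      else 0
    else
      (if x i = x' i + 1 then v else if x i = x' i then 1 - v else 0)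

/-- `t`-step probability of the backward-sequential-update TASEP started from `x0`. -/
def Pbw (v : ℝ) {P : ℕ} (x0 : Fin P → ℤ) : ℕ → (Fin P → ℤ) → ℝ
  | 0 => fun x => if x = x0 then 1 else 0
  | t + 1 => fun x => ∑ k : Fin P → Bool,
      if StrictMono (shiftBy x k) then
        TBw v x (shiftBy x k) * Pbw v x0 t (shiftBy x k)
      else 0

/-- Reversed-negated configuration `ι(X)_i = -x_{P+1-i}`. -/
def iota {P : ℕ} (x : Fin P → ℤ) : Fin P → ℤ := fun i => - x i.rev

/-- `i` is a cluster head of `x` (first particle of a cluster). -/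
def isHead {P : ℕ} (x : Fin P → ℤ) (i : Fin P) : Prop :=
  ∀ j : Fin P, (i : ℕ) = (j : ℕ) + 1 → x j + 1 < x i

/-- Position of the `i`-th walker at time `s`, given steps `ε`. -/
def walkerPos {P t : ℕ} (x0 : Fin P → ℤ) (ε : Fin P → Fin t → Bool) (i : Fin P) (s : ℕ) : ℤ :=
  x0 i + ((Finset.univ.filter fun u : Fin t => (u : ℕ) < s ∧ ε i u = true).card : ℤ)

/-- General Bethe-ansatz sum with amplitudes `A`. -/
def betheSum {P : ℕ} (z : Fin P → ℂ) (A : Equiv.Perm (Fin P) → ℂ) (x : Fin P → ℤ) : ℂ :=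
  ∑ σ : Equiv.Perm (Fin P), A σ * ∏ i : Fin P, z (σ i) ^ (-(x i))

/-- `ξ(z) = -(1+λz)/(1-1/z)`. -/
def xiC (v : ℝ) (z : ℂ) : ℂ := -(1 + (lam v : ℂ) * z) / (1 - 1 / z)

/-- Bethe amplitudes `A_σ = sgn(σ) ∏ ξ_{σ(i)}^{i-σ(i)}`. -/
def ampA (v : ℝ) {P : ℕ} (z : Fin P → ℂ) (σ : Equiv.Perm (Fin P)) : ℂ :=
  ((Equiv.Perm.sign σ : ℤ) : ℂ) * ∏ i : Fin P, xiC v (z (σ i)) ^ ((i : ℤ) - (σ i : ℤ))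

/-- The Bethe eigenfunction `B(x)`. -/
def betheB (v : ℝ) {P : ℕ} (z : Fin P → ℂ) (x : Fin P → ℤ) : ℂ :=
  betheSum z (ampA v z) x

/-- The formal inverse power `(1 - ν S)^{-q}` acting on `g`, where `S` is the shift by `-e`:
`∑ l, binom(q+l-1,l) ν^l g(N + e l)`. -/
def invPow (ν : ℝ) (e : ℤ) (q : ℕ) (g : ℤ → ℝ) (N : ℤ) : ℝ :=
  ∑' l : ℕ, ((q + l - 1).choose l : ℝ) * ν ^ l * g (N + e * l)

/-- The power `(1 + μ S)^p` acting on `g`, where `S` is the shift by `e`: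
`∑ n ≤ p, binom(p,n) μ^n g(N - e n)`. -/
def binPow (μ : ℝ) (e : ℤ) (p : ℕ) (g : ℤ → ℝ) (N : ℤ) : ℝ :=
  ∑ n ∈ Finset.range (p + 1), (p.choose n : ℝ) * μ ^ n * g (N - e * n)

lemma summable_mul_shift {g : ℤ → ℝ} (hg : (Function.support g).Finite) {e : ℤ} (he : e ≠ 0)
    (c : ℕ → ℝ) (N : ℤ) : Summable fun l : ℕ => c l * g (N + e * l) := by
  apply summable_of_hasFiniteSupport
  have hinj : Function.Injective fun l : ℕ => N + e * (l : ℤ) := by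
    intro a b h
    simpa [he] using h
  exact (hg.preimage hinj.injOn).subset fun l hl => right_ne_zero_of_mul hl

lemma invPow_succ {g : ℤ → ℝ} (hg : (Function.support g).Finite) {e : ℤ} (he : e ≠ 0)
    (ν : ℝ) (q : ℕ) (N : ℤ) :
    invPow ν e (q + 1) g N - ν * invPow ν e (q + 1) g (N + e) = invPow ν e q g N := by
  unfold invPow
  rw [(summable_mul_shift hg he (fun l => ((q + 1 + l - 1).choose l : ℝ) * ν ^ l) N).tsum_eq_zero_add,
    (summable_mul_shift hg he (fun l => ((q + l - 1).choose l : ℝ) * ν ^ l) N).tsum_eq_zero_add,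
    ← tsum_mul_left, add_sub_assoc, ← Summable.tsum_sub]
  · congr 1
    · simp
    · refine tsum_congr fun l => ?_
      have h : (q + 1 + (l + 1) - 1).choose (l + 1)
          = (q + l).choose l + (q + l).choose (l + 1) := by
        rw [← Nat.choose_succ_succ']; congr 1; omega
      rw [h]
      have h1 : q + 1 + l - 1 = q + l := by omega
      have h2 : q + (l + 1) - 1 = q + l := by omega
      have h3 : N + e + e * (l : ℤ) = N + e * ((l + 1 : ℕ) : ℤ) := by push_cast; ring
      rw [h1, h2, h3]
      push_cast
      ring
  · exact (summable_nat_add_iff 1).2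
      (summable_mul_shift hg he (fun l => ((q + 1 + l - 1).choose l : ℝ) * ν ^ l) N)
  · exact (summable_mul_shift hg he _ (N + e)).mul_left ν

lemma binPow_succ (μ : ℝ) (e : ℤ) (p : ℕ) (g : ℤ → ℝ) (N : ℤ) :
    binPow μ e (p + 1) g N = binPow μ e p g N + μ * binPow μ e p g (N - e) := by
  unfold binPow
  rw [Finset.sum_range_succ' _ (p + 1), Finset.sum_congr rfl (g := fun n =>
    (p.choose n : ℝ) * μ ^ (n + 1) * g (N - e * (n + 1 : ℕ)) +
    (p.choose (n + 1) : ℝ) * μ ^ (n + 1) * g (N - e * (n + 1 : ℕ))) (fun n _ => by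
      rw [Nat.choose_succ_succ']; push_cast; ring), Finset.sum_add_distrib,
    Finset.sum_range_succ (fun n => (p.choose (n + 1) : ℝ) * μ ^ (n + 1) * g (N - e * (n + 1 : ℕ))) p,
    Finset.sum_range_succ' (fun n => (p.choose n : ℝ) * μ ^ n * g (N - e * n)) p, Finset.mul_sum]
  have h : ∀ n : ℕ, μ * ((p.choose n : ℝ) * μ ^ n * g (N - e - e * n))
      = (p.choose n : ℝ) * μ ^ (n + 1) * g (N - e * (n + 1 : ℕ)) := by
    intro n
    rw [show N - e - e * (n : ℤ) = N - e * ((n + 1 : ℕ) : ℤ) by push_cast; ring]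
    ring
  simp only [h]
  simp
  ring

lemma binPow_comb (μ : ℝ) (e : ℤ) (p : ℕ) (g h : ℤ → ℝ) (a b : ℝ) (d : ℤ)
    (hgh : ∀ N, h N = a * g N + b * g (N + d)) (N : ℤ) :
    binPow μ e p h N = a * binPow μ e p g N + b * binPow μ e p g (N + d) := by
  unfold binPow
  rw [Finset.mul_sum, Finset.mul_sum, ← Finset.sum_add_distrib]
  refine Finset.sum_congr rfl fun n _ => ?_
  rw [hgh, show N + d - e * (n : ℤ) = N - e * n + d by ring]
  ring

lemma invPow_comb {g : ℤ → ℝ} (hg : (Function.support g).Finite) {e : ℤ} (he : e ≠ 0)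
    (ν : ℝ) (q : ℕ) (h : ℤ → ℝ) (a b : ℝ) (d : ℤ)
    (hgh : ∀ N, h N = a * g N + b * g (N + d)) (N : ℤ) :
    invPow ν e q h N = a * invPow ν e q g N + b * invPow ν e q g (N + d) := by
  unfold invPow
  rw [← tsum_mul_left, ← tsum_mul_left, ← Summable.tsum_add]
  · refine tsum_congr fun l => ?_
    rw [hgh, show N + d + e * (l : ℤ) = N + e * l + d by ring]
    ring
  · exact (summable_mul_shift hg he _ N).mul_left a
  · exact (summable_mul_shift hg he _ (N + d)).mul_left b

/-- The operator `((1 + μ S^e) / (1 - ν S^{-e}))^m` with `S` the unit shift. -/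
def ratPow (μ ν : ℝ) (e : ℤ) (m : ℕ) (g : ℤ → ℝ) : ℤ → ℝ :=
  binPow μ e m (invPow ν e m g)

lemma ratPow_succ {g : ℤ → ℝ} (hg : (Function.support g).Finite) {e : ℤ} (he : e ≠ 0)
    (μ ν : ℝ) (m : ℕ) (N : ℤ) :
    ratPow μ ν e (m + 1) g N - ν * ratPow μ ν e (m + 1) g (N + e)
      = ratPow μ ν e m g N + μ * ratPow μ ν e m g (N - e) := by
  unfold ratPow
  rw [← binPow_succ, binPow_comb μ e (m + 1) (invPow ν e (m + 1) g) (invPow ν e m g) 1 (-ν) e]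
  · ring
  · intro N
    rw [← invPow_succ hg he]
    ring

lemma ratPow_comb {g : ℤ → ℝ} (hg : (Function.support g).Finite) {e : ℤ} (he : e ≠ 0)
    (μ ν : ℝ) (m : ℕ) (h : ℤ → ℝ) (a b : ℝ) (d : ℤ)
    (hgh : ∀ N, h N = a * g N + b * g (N + d)) (N : ℤ) :
    ratPow μ ν e m h N = a * ratPow μ ν e m g N + b * ratPow μ ν e m g (N + d) :=
  binPow_comb _ _ _ _ _ _ _ _ (invPow_comb hg he ν m h a b d hgh) N

lemma invPow_eq_of_le {g : ℤ → ℝ} {e : ℤ} (he : e = 1 ∨ e = -1)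
    (hg : ∀ N, 0 < e * N → g N = 0) (ν : ℝ) (q : ℕ) {N : ℤ} (hN : 0 ≤ e * N) :
    invPow ν e q g N = g N := by
  unfold invPow
  rw [tsum_eq_single 0]
  · simp
  · intro l hl
    rw [hg, mul_zero]
    rcases he with rfl | rfl <;> omega

lemma ratPow_eq_zero {g : ℤ → ℝ} {e : ℤ} (he : e = 1 ∨ e = -1)
    (hg : ∀ N, 0 < e * N → g N = 0) (μ ν : ℝ) (m : ℕ) {N : ℤ} (hN : (m : ℤ) < e * N) :
    ratPow μ ν e m g N = 0 := by
  unfold ratPow binPow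
  refine Finset.sum_eq_zero fun n hn => ?_
  have hn' : n < m + 1 := Finset.mem_range.1 hn
  have h : 0 < e * (N - e * n) := by rcases he with rfl | rfl <;> omega
  rw [invPow_eq_of_le he hg ν m h.le, hg _ h, mul_zero]

lemma ratPow_edge {g : ℤ → ℝ} {e : ℤ} (he : e = 1 ∨ e = -1)
    (hg : ∀ N, 0 < e * N → g N = 0) (μ ν : ℝ) (m : ℕ) {N : ℤ} (hN : e * N = m) :
    ratPow μ ν e m g N = μ ^ m * g 0 := by
  have h0 : N - e * m = 0 := by rcases he with rfl | rfl <;> omega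
  unfold ratPow binPow
  rw [Finset.sum_eq_single m]
  · rw [h0, invPow_eq_of_le he hg ν m (by simp), Nat.choose_self]
    simp
  · intro n hn hnm
    have hn' : n < m + 1 := Finset.mem_range.1 hn
    have h : 0 < e * (N - e * n) := by rcases he with rfl | rfl <;> omega
    rw [invPow_eq_of_le he hg ν m h.le, hg _ h, mul_zero]
  · simp

lemma support_F0_finite (v : ℝ) (t : ℕ) : (Function.support fun N => F0 v N t).Finite := by
  refine (Set.finite_Icc (0 : ℤ) t).subset fun N hN => ?_
  by_contra h
  exact hN (if_neg h)

lemma F0_succ {v : ℝ} (t : ℕ) (N : ℤ) :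
    F0 v N (t + 1) = (1 - v) * F0 v N t + v * F0 v (N + -1) t := by
  unfold F0
  rcases lt_or_ge N 0 with h | h
  · rw [if_neg (by omega), if_neg (by omega), if_neg (by omega)]; ring
  lift N to ℕ using h
  rcases N with _ | n
  · rw [if_pos (by omega), if_pos (by simp), if_neg (by simp)]
    simp [pow_succ]
    ring
  · have e1 : ((n + 1 : ℕ) : ℤ) + -1 = (n : ℤ) := by push_cast; ring
    simp only [e1, Int.toNat_natCast]
    rcases lt_trichotomy n t with h | h | h
    · rw [if_pos (by omega), if_pos (by omega), if_pos (by omega), Nat.choose_succ_succ']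
      obtain ⟨d, rfl⟩ := Nat.exists_eq_add_of_lt h
      rw [show n + d + 1 + 1 - (n + 1) = d + 1 by omega, show n + d + 1 - (n + 1) = d by omega,
        show n + d + 1 - n = d + 1 by omega]
      push_cast
      ring
    · subst h
      rw [if_pos (by omega), if_neg (by omega), if_pos (by omega)]
      simp
      ring
    · rw [if_neg (by omega), if_neg (by omega), if_neg (by omega)]; ring

lemma tsum_int_ge (n : ℕ) (c : ℕ → ℝ) (G : ℤ → ℝ) :
    (∑' k : ℤ, if -(n : ℤ) ≤ k then c ((n : ℤ) + k).toNat * G k else 0)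
      = ∑' l : ℕ, c l * G ((l : ℤ) - n) := by
  have hinj : Function.Injective fun l : ℕ => (l : ℤ) - n := by
    intro a b h
    simpa using h
  rw [← hinj.tsum_eq]
  · refine tsum_congr fun l => ?_
    rw [if_pos (by omega)]
    congr 2
    omega
  · intro k hk
    have : -(n : ℤ) ≤ k := by
      by_contra h
      exact hk (if_neg h)
    exact ⟨((n : ℤ) + k).toNat, by simp only; omega⟩

lemma ratPow_zero (μ ν : ℝ) (e : ℤ) (g : ℤ → ℝ) : ratPow μ ν e 0 g = g := by
  funext N
  unfold ratPow binPow invPow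
  rw [Finset.sum_range_one, tsum_eq_single 0]
  · simp
  · intro l hl
    rw [Nat.choose_eq_zero_of_lt (by omega)]
    simp

lemma Ftil_natCast (v : ℝ) (m : ℕ) (N : ℤ) (t : ℕ) :
    Ftil v m N t = ratPow (lam v) 1 1 m (fun N => F0 v N t) N := by
  rcases m.eq_zero_or_pos with rfl | hm
  · simp [Ftil, ratPow_zero]
  unfold Ftil ratPow binPow invPow
  rw [if_pos (by omega)]
  refine Finset.sum_congr rfl fun n _ => ?_
  rw [← tsum_mul_left]
  refine Eq.trans ?_ ((tsum_int_ge n (fun l => (m.choose n : ℝ) * ((m + l - 1).choose l : ℝ) *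
    lam v ^ n) fun k => F0 v (N + k) t).trans ?_)
  · refine tsum_congr fun k => ?_
    split_ifs with h
    · rw [Int.toNat_natCast, show ((m : ℤ) + n + k - 1).toNat = m + ((n : ℤ) + k).toNat - 1 by omega]
    · rfl
  · refine tsum_congr fun l => ?_
    rw [show N + ((l : ℤ) - n) = N - 1 * n + 1 * l by ring]
    ring

lemma Ftil_neg_natCast (v : ℝ) (m : ℕ) (N : ℤ) (t : ℕ) :
    Ftil v (-(m : ℤ)) N t = ratPow (-1) (-lam v) (-1) m (fun N => F0 v N t) N := by
  rcases m.eq_zero_or_pos with rfl | hm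
  · simp [Ftil, ratPow_zero]
  unfold Ftil ratPow binPow invPow
  rw [if_neg (by omega), if_neg (by omega), Int.natAbs_neg, Int.natAbs_natCast]
  refine Finset.sum_congr rfl fun n _ => ?_
  rw [← tsum_mul_left]
  refine Eq.trans ?_ ((tsum_int_ge n (fun l => (-1 : ℝ) ^ n * (m.choose n : ℝ) *
    ((m + l - 1).choose l : ℝ) * (-lam v) ^ l) fun k => F0 v (N - k) t).trans ?_)
  · refine tsum_congr fun k => ?_
    split_ifs with h
    · rw [show ((m : ℤ) + n + k - 1).toNat = m + ((n : ℤ) + k).toNat - 1 by omega]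
    · rfl
  · refine tsum_congr fun l => ?_
    rw [show N - ((l : ℤ) - n) = N - -1 * n + -1 * l by ring]
    ring

lemma Ftil_time_succ (v : ℝ) (m N : ℤ) (t : ℕ) :
    Ftil v m N (t + 1) = (1 - v) * Ftil v m N t + v * Ftil v m (N - 1) t := by
  obtain ⟨m, rfl | rfl⟩ := m.eq_nat_or_neg
  · simp only [Ftil_natCast]
    exact ratPow_comb (support_F0_finite v t) one_ne_zero _ _ _ _ _ _ _ (F0_succ t) N
  · simp only [Ftil_neg_natCast]
    exact ratPow_comb (support_F0_finite v t) (by norm_num) _ _ _ _ _ _ _ (F0_succ t) N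

lemma Ftil_sub_shift (v : ℝ) (m N : ℤ) (t : ℕ) :
    Ftil v (m + 1) N t - Ftil v (m + 1) (N + 1) t
      = Ftil v m N t + lam v * Ftil v m (N - 1) t := by
  rcases le_or_gt 0 m with h | h
  · lift m to ℕ using h
    have := ratPow_succ (support_F0_finite v t) one_ne_zero (lam v) 1 m N
    rw [← Nat.cast_succ]
    simp only [Ftil_natCast]
    simpa using this
  · obtain ⟨M, rfl⟩ : ∃ M : ℕ, m = -((M + 1 : ℕ) : ℤ) := ⟨(-m - 1).toNat, by omega⟩
    have := ratPow_succ (support_F0_finite v t) (e := -1) (by norm_num) (-1) (-lam v) M N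
    rw [show -((M + 1 : ℕ) : ℤ) + 1 = -(M : ℤ) by push_cast; ring]
    simp only [Ftil_neg_natCast]
    rw [show N - -1 = N + 1 by ring, show N + -1 = N - 1 by ring] at this
    linarith

lemma Ftil_time_pred {v : ℝ} (hv : v ≠ 1) (m N : ℤ) (t : ℕ) :
    Ftil v (m + 1) (N + 1) (t + 1)
      = Ftil v (m + 1) (N + 1) t + lam v * Ftil v m N (t + 1) := by
  have h := Ftil_sub_shift v m N t
  rw [Ftil_time_succ v (m + 1), Ftil_time_succ v m]
  have hl : lam v * (1 - v) = v := div_mul_cancel₀ v (sub_ne_zero.2 hv.symm)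
  rw [add_sub_cancel_right]
  linear_combination v * h - Ftil v m N t * hl

lemma F0_zero (v : ℝ) (N : ℤ) : F0 v N 0 = if N = 0 then 1 else 0 := by
  unfold F0
  by_cases h : N = 0
  · simp [h]
  · rw [if_neg h, if_neg (by push_cast; omega)]

lemma Ftil_zero_pos (v : ℝ) {m N : ℤ} (hm : 0 ≤ m) (hN : m < N) : Ftil v m N 0 = 0 := by
  lift m to ℕ using hm
  rw [Ftil_natCast, ratPow_eq_zero (.inl rfl) _ _ _ _ (by omega)]
  intro N hN
  rw [F0_zero, if_neg (by omega)]

lemma Ftil_zero_pos_edge (v : ℝ) {m : ℕ} : Ftil v m m 0 = lam v ^ m := by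
  rw [Ftil_natCast, ratPow_edge (.inl rfl) _ _ _ _ (by omega)]
  · simp [F0_zero]
  intro N hN
  rw [F0_zero, if_neg (by omega)]

lemma Ftil_zero_neg (v : ℝ) {m N : ℤ} (hm : m ≤ 0) (hN : N < m) : Ftil v m N 0 = 0 := by
  obtain ⟨M, rfl⟩ : ∃ M : ℕ, m = -(M : ℤ) := ⟨(-m).toNat, by omega⟩
  rw [Ftil_neg_natCast, ratPow_eq_zero (.inr rfl) _ _ _ _ (by omega)]
  intro N hN
  rw [F0_zero, if_neg (by omega)]

lemma Ftil_zero_neg_edge (v : ℝ) (m : ℕ) : Ftil v (-(m : ℤ)) (-(m : ℤ)) 0 = (-1) ^ m := by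
  rw [Ftil_neg_natCast, ratPow_edge (.inr rfl) _ _ _ _ (by omega)]
  · simp [F0_zero]
  intro N hN
  rw [F0_zero, if_neg (by omega)]


lemma det_eq_zero_of_zero_block {n : ℕ} (M : Matrix (Fin n) (Fin n) ℝ) (a : Fin n)
    (h : ∀ i j, i ≤ a → a ≤ j → M i j = 0) : M.det = 0 := by
  rw [Matrix.det_apply]
  refine Finset.sum_eq_zero fun σ _ => ?_
  obtain ⟨j, hj, hσ⟩ : ∃ j, a ≤ j ∧ σ j ≤ a := by
    by_contra! hcon
    have hcard := Finset.card_le_card_of_injOn (s := Finset.Ici a) (t := Finset.Ioi a) σ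
      (fun j hj => by simpa using hcon j (by simpa using hj)) σ.injective.injOn
    rw [Fin.card_Ici, Fin.card_Ioi] at hcard
    omega
  exact smul_eq_zero_of_right _ (Finset.prod_eq_zero (Finset.mem_univ j) (h _ _ hσ hj))

lemma add_le_of_strictMono {n : ℕ} {x : Fin n → ℤ} (hx : StrictMono x) {i j : Fin n}
    (hij : i ≤ j) : x i + ((j : ℤ) - (i : ℤ)) ≤ x j := by
  obtain ⟨j, hj⟩ := j
  induction j with
  | zero =>
    have : i = ⟨0, hj⟩ := le_antisymm hij (Fin.mk_le_of_le_val (Nat.zero_le _))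
    subst this
    simp
  | succ j ih =>
    rcases hij.eq_or_lt with rfl | hlt
    · simp
    · have h1 := ih (by omega) (by rw [Fin.lt_def] at hlt; rw [Fin.le_def]; simp at hlt ⊢; omega)
      have h2 := hx (show (⟨j, by omega⟩ : Fin n) < ⟨j + 1, hj⟩ by rw [Fin.lt_def]; simp)
      push_cast at h1 ⊢
      omega

lemma pow_nPairs_eq_prod_next (r : ℝ) {P : ℕ} (x : Fin P → ℤ) :
    r ^ nPairs x = ∏ i : Fin P,
      if ∃ j : Fin P, (j : ℕ) = (i : ℕ) + 1 ∧ x j = x i + 1 then r else 1 := by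
  rw [Finset.prod_ite, Finset.prod_const, Finset.prod_const_one, mul_one]
  congr 1
  refine Finset.card_bij (fun p _ => p.1) ?_ ?_ ?_
  · intro p hp
    simp only [Finset.mem_filter, Finset.mem_univ, true_and] at hp ⊢
    exact ⟨p.2, hp⟩
  · intro p hp q hq hpq
    simp only [Finset.mem_filter, Finset.mem_univ, true_and] at hp hq
    refine Prod.ext hpq (Fin.ext ?_)
    rw [hp.1, hq.1, hpq]
  · intro i hi
    simp only [Finset.mem_filter, Finset.mem_univ, true_and] at hi
    obtain ⟨j, hj⟩ := hi
    exact ⟨(i, j), by simpa using hj, rfl⟩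

lemma pow_nPairs_eq_prod_succ (r : ℝ) {n : ℕ} (x : Fin (n + 1) → ℤ) :
    r ^ nPairs x = ∏ i : Fin n, if x i.succ = x i.castSucc + 1 then r else 1 := by
  rw [pow_nPairs_eq_prod_next, Fin.prod_univ_castSucc, if_neg, mul_one]
  · refine Finset.prod_congr rfl fun i _ => if_congr ⟨?_, ?_⟩ rfl rfl
    · rintro ⟨j, hj, h⟩
      obtain rfl : j = i.succ := Fin.ext (by simpa using hj)
      exact h
    · exact fun h => ⟨i.succ, by simp, h⟩
  · rintro ⟨j, hj, -⟩
    have := j.2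
    simp at hj
    omega

/-- Row `i` is not the first one and its particle has a neighbor on its left. -/
def hasLeftNeighbor {n : ℕ} (x : Fin (n + 1) → ℤ) : Fin (n + 1) → Prop :=
  Fin.cases False fun i => x i.succ = x i.castSucc + 1

lemma hasLeftNeighbor_succ {n : ℕ} (x : Fin (n + 1) → ℤ) (i : Fin n) :
    hasLeftNeighbor x i.succ ↔ x i.succ = x i.castSucc + 1 := Iff.rfl

lemma Ftil_initial_det {v : ℝ} (hv : v ≠ 1) {n : ℕ} (x x0 : Fin (n + 1) → ℤ)
    (hx0 : StrictMono x0) (hx : StrictMono x) :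
    (1 - v) ^ nPairs x *
      (Matrix.of fun i j : Fin (n + 1) => Ftil v ((i : ℤ) - (j : ℤ)) (x i - x0 j) 0).det
      = if x = x0 then 1 else 0 := by
  by_cases hxx : x = x0
  · subst hxx
    rw [if_pos rfl]
    have hadj : ∀ j : Fin n, x j.castSucc < x j.succ := fun j => hx j.castSucc_lt_succ
    set A : Matrix (Fin (n + 1)) (Fin (n + 1)) ℝ :=
      Matrix.of fun i j => Ftil v ((i : ℤ) - (j : ℤ)) (x i - x j) 0 with hA
    let c : Fin n → ℝ := fun j => if x j.succ = x j.castSucc + 1 then 1 else 0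
    let B : Matrix (Fin (n + 1)) (Fin (n + 1)) ℝ := Matrix.of fun i j =>
      Fin.cases (motive := fun _ => ℝ) (A i 0) (fun j => A i j.succ + c j * A i j.castSucc) j
    have hdet : A.det = B.det := by
      refine Matrix.det_eq_of_forall_col_eq_smul_add_pred (fun j => -c j) (fun i => rfl)
        fun i j => ?_
      simp only [B, Matrix.of_apply, Fin.cases_succ]
      ring
    have hdiag : ∀ i, A i i = 1 := by
      intro i
      simp [hA, Ftil, F0_zero]
    have htri : B.BlockTriangular OrderDual.toDual := by
      intro i j hij
      have hij' : i < j := hij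
      obtain ⟨j, rfl⟩ := Fin.exists_succ_eq.2 (Fin.ne_zero_of_lt hij')
      have hle : i ≤ j.castSucc := Fin.le_castSucc_iff.2 hij'
      have hle' : (i : ℕ) ≤ j := hle
      have hmono := add_le_of_strictMono hx hle
      simp only [Fin.val_castSucc] at hmono
      have hj := hadj j
      simp only [B, c, hA, Matrix.of_apply, Fin.cases_succ, Fin.val_succ, Fin.val_castSucc]
      push_cast
      split_ifs with h
      · rcases hmono.eq_or_lt with he | hlt
        · obtain ⟨d, hd⟩ := Nat.exists_eq_add_of_le hle'
          rw [show (i : ℤ) - ((j : ℕ) + 1) = -((d + 1 : ℕ) : ℤ) by push_cast; omega,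
            show x i - x j.succ = -((d + 1 : ℕ) : ℤ) by push_cast; omega,
            show (i : ℤ) - (j : ℕ) = -(d : ℤ) by omega,
            show x i - x j.castSucc = -(d : ℤ) by omega,
            Ftil_zero_neg_edge, Ftil_zero_neg_edge]
          ring
        · rw [Ftil_zero_neg v (by omega) (by omega), Ftil_zero_neg v (by omega) (by omega)]
          ring
      · rw [Ftil_zero_neg v (by omega) (by omega)]
        ring
    rw [hdet, Matrix.det_of_isLowerTriangular B htri, Fin.prod_univ_succ, pow_nPairs_eq_prod_succ]
    have h0 : B 0 0 = 1 := hdiag 0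
    rw [h0, one_mul, ← Finset.prod_mul_distrib]
    refine Finset.prod_eq_one fun j _ => ?_
    simp only [B, c, Matrix.of_apply, Fin.cases_succ, hdiag]
    split_ifs with h
    · have h1 : A j.succ j.castSucc = lam v := by
        simp only [hA, Matrix.of_apply, h, Fin.val_succ, Fin.val_castSucc]
        rw [show ((j : ℕ) + 1 : ℕ) - ((j : ℕ) : ℤ) = ((1 : ℕ) : ℤ) by push_cast; ring,
          show x j.castSucc + 1 - x j.castSucc = ((1 : ℕ) : ℤ) by push_cast; ring,
          Ftil_zero_pos_edge, pow_one]
      have hv' : 1 - v ≠ 0 := sub_ne_zero.2 hv.symm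
      rw [h1, lam]
      field_simp
      ring
    · ring
  · rw [if_neg hxx]
    obtain ⟨a, ha⟩ := Function.ne_iff.1 hxx
    rw [mul_eq_zero]
    right
    rcases ha.lt_or_gt with h | h
    · refine det_eq_zero_of_zero_block _ a fun i j hi hj => ?_
      have h1 := add_le_of_strictMono hx hi
      have h2 := add_le_of_strictMono hx0 hj
      have hi' : (i : ℕ) ≤ a := hi
      have hj' : (a : ℕ) ≤ j := hj
      exact Ftil_zero_neg v (by omega) (by omega)
    · rw [← Matrix.det_transpose]
      refine det_eq_zero_of_zero_block _ a fun j i hj hi => ?_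
      have h1 := add_le_of_strictMono hx hi
      have h2 := add_le_of_strictMono hx0 hj
      have hi' : (a : ℕ) ≤ i := hi
      have hj' : (j : ℕ) ≤ a := hj
      exact Ftil_zero_pos v (by omega) (by omega)

/-- The weight of the move `k` of particle `i` ending in `x`: free binomial weights, except that a
particle that has a left neighbor in the final configuration cannot have moved. -/
def moveWeight (v : ℝ) {n : ℕ} (x : Fin (n + 1) → ℤ) (i : Fin (n + 1)) (k : Bool) : ℝ :=
  if k then (if hasLeftNeighbor x i then 0 else v) else 1 - v

lemma Tstep_mul_pow_nPairs (v : ℝ) {n : ℕ} {x : Fin (n + 1) → ℤ} (hx : StrictMono x)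
    (k : Fin (n + 1) → Bool) :
    (if StrictMono (shiftBy x k) then
      Tstep v x (shiftBy x k) * (1 - v) ^ nPairs (shiftBy x k) else 0)
      = ∏ i, moveWeight v x i (k i) := by
  have hadj : ∀ j : Fin n, x j.castSucc < x j.succ := fun j => hx j.castSucc_lt_succ
  by_cases hk : ∃ i : Fin n, x i.succ = x i.castSucc + 1 ∧ k i.succ = true
  · obtain ⟨i, hi, hki⟩ := hk
    rw [Finset.prod_eq_zero (Finset.mem_univ i.succ)
      (by simp [moveWeight, hasLeftNeighbor, hki, hi])]
    split_ifs with hmono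
    · have hlt := hmono i.castSucc_lt_succ
      have hkc : k i.castSucc = true := by
        by_contra hkc
        simp [shiftBy, hki, hi, hkc] at hlt
      rw [Tstep, Finset.prod_eq_zero (Finset.mem_univ i.castSucc), zero_mul]
      have hno : ¬ ∀ j : Fin (n + 1), (j : ℕ) = (i.castSucc : ℕ) + 1 →
          shiftBy x k i.castSucc + 1 < shiftBy x k j := by
        intro h
        have := h i.succ (by simp)
        simp [shiftBy, hki, hi, hkc] at this
      have hne : x i.castSucc ≠ shiftBy x k i.castSucc := by
        simp only [shiftBy, hkc, if_true]
        omega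
      rw [if_neg (fun h => hno h.2), if_neg (fun h => hno h.2), if_neg (fun h => hne h.1)]
    · rfl
  · push Not at hk
    have hmono : StrictMono (shiftBy x k) := by
      refine Fin.strictMono_iff_lt_succ.2 fun i => ?_
      have h1 := hadj i
      have h2 := hk i
      simp only [shiftBy]
      by_cases h3 : x i.succ = x i.castSucc + 1
      · rw [if_neg (h2 h3)]
        split_ifs <;> omega
      · split_ifs <;> omega
    rw [if_pos hmono, Tstep, pow_nPairs_eq_prod_next, ← Finset.prod_mul_distrib]
    refine Finset.prod_congr rfl fun i _ => ?_
    cases hki : k i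
    · have hxi : x i = shiftBy x k i := by simp [shiftBy, hki]
      rw [if_neg (fun h => by omega), moveWeight, if_neg (by simp : ¬ false = true)]
      by_cases hn : ∃ j : Fin (n + 1), (j : ℕ) = (i : ℕ) + 1 ∧
          shiftBy x k j = shiftBy x k i + 1
      · have hno : ¬ ∀ j : Fin (n + 1), (j : ℕ) = (i : ℕ) + 1 →
            shiftBy x k i + 1 < shiftBy x k j := by
          intro h
          obtain ⟨j, hj, hj'⟩ := hn
          exact (h j hj).ne' hj'
        rw [if_neg (fun h => hno h.2), if_pos ⟨hxi, hn⟩, if_pos hn, one_mul]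
      · have hall : ∀ j : Fin (n + 1), (j : ℕ) = (i : ℕ) + 1 →
            shiftBy x k i + 1 < shiftBy x k j := by
          intro j hj
          have hlt : shiftBy x k i < shiftBy x k j := hmono (Fin.lt_def.2 (by omega))
          have hne : shiftBy x k j ≠ shiftBy x k i + 1 := fun h => hn ⟨j, hj, h⟩
          omega
        rw [if_pos ⟨hxi, hall⟩, if_neg hn, mul_one]
    · have hxi : x i = shiftBy x k i + 1 := by simp [shiftBy, hki]
      have hall : ∀ j : Fin (n + 1), (j : ℕ) = (i : ℕ) + 1 →
          shiftBy x k i + 1 < shiftBy x k j := by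
        intro j hj
        rw [← hxi]
        obtain ⟨a, rfl⟩ : ∃ a : Fin n, i = a.castSucc := ⟨⟨i, by omega⟩, rfl⟩
        obtain rfl : j = a.succ := Fin.ext hj
        have h1 := hadj a
        have h2 := hk a
        simp only [shiftBy]
        split_ifs with h3
        · have : x a.succ ≠ x a.castSucc + 1 := fun h => h2 h h3
          omega
        · omega
      have hn : ¬ ∃ j : Fin (n + 1), (j : ℕ) = (i : ℕ) + 1 ∧
          shiftBy x k j = shiftBy x k i + 1 := by
        rintro ⟨j, hj, hj'⟩
        exact (hall j hj).ne' hj'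
      rw [if_pos ⟨hxi, hall⟩, if_neg hn, mul_one, moveWeight, if_pos rfl, if_neg]
      intro hh
      induction i using Fin.cases with
      | zero => exact hh
      | succ i => exact hk i hh hki

lemma Ftil_det_time_succ {v : ℝ} (hv : v ≠ 1) {n : ℕ} (x x0 : Fin (n + 1) → ℤ) (t : ℕ) :
    (1 - v) ^ nPairs x *
      (Matrix.of fun i j : Fin (n + 1) => Ftil v ((i : ℤ) - (j : ℤ)) (x i - x0 j) (t + 1)).det
      = (Matrix.of fun i j : Fin (n + 1) => ∑ b : Bool, moveWeight v x i b *
          Ftil v ((i : ℤ) - (j : ℤ)) (x i - (if b then 1 else 0) - x0 j) t).det := by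
  set A : Matrix (Fin (n + 1)) (Fin (n + 1)) ℝ :=
    Matrix.of fun i j => Ftil v ((i : ℤ) - (j : ℤ)) (x i - x0 j) (t + 1) with hA
  let B : Matrix (Fin (n + 1)) (Fin (n + 1)) ℝ := Matrix.of fun i j =>
    if hasLeftNeighbor x i then Ftil v ((i : ℤ) - (j : ℤ)) (x i - x0 j) t else A i j
  have hdet : A.det = B.det := by
    refine Matrix.det_eq_of_forall_row_eq_smul_add_pred
      (fun i => if x i.succ = x i.castSucc + 1 then lam v else 0) (fun j => ?_) fun i j => ?_
    · simp [B, hasLeftNeighbor]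
    · simp only [B, hA, Matrix.of_apply, hasLeftNeighbor_succ]
      by_cases h : x i.succ = x i.castSucc + 1
      · rw [if_pos h, if_pos h]
        have := Ftil_time_pred hv ((i : ℤ) - j) (x i.castSucc - x0 j) t
        simp only [h, Fin.val_succ, Fin.val_castSucc]
        push_cast
        convert this using 3 <;> ring
      · rw [if_neg h, if_neg h, zero_mul, add_zero]
  have hpow : (1 - v) ^ nPairs x = ∏ i, if hasLeftNeighbor x i then 1 - v else 1 := by
    rw [pow_nPairs_eq_prod_succ, Fin.prod_univ_succ,
      if_neg (id : ¬ hasLeftNeighbor x 0), one_mul]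
    exact Finset.prod_congr rfl fun i _ => if_congr (hasLeftNeighbor_succ x i).symm rfl rfl
  rw [hdet, hpow, ← Matrix.det_mul_column]
  congr 1
  ext i j
  simp only [B, hA, Matrix.of_apply, Fintype.sum_bool, moveWeight, if_true,
    Bool.false_eq_true, if_false, sub_zero]
  split_ifs with h
  · ring
  · rw [Ftil_time_succ, show x i - 1 - x0 j = x i - x0 j - 1 by ring]
    ring

lemma det_sum_mul_row {n : ℕ} (w : Fin n → Bool → ℝ) (G : Fin n → Bool → Fin n → ℝ) :
    (Matrix.of fun i j => ∑ b : Bool, w i b * G i b j).det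
      = ∑ k : Fin n → Bool, (∏ i, w i (k i)) * (Matrix.of fun i j => G i (k i) j).det := by
  have h := (Matrix.detRowAlternating (n := Fin n) (R := ℝ)).toMultilinearMap.map_sum
    (fun i (b : Bool) => w i b • G i b)
  have h1 : (Matrix.of fun i j => ∑ b : Bool, w i b * G i b j)
      = fun i => ∑ b : Bool, w i b • G i b := by
    ext i j
    simp
  rw [h1]
  refine h.trans (Finset.sum_congr rfl fun k _ => ?_)
  exact (Matrix.detRowAlternating (n := Fin n) (R := ℝ)).toMultilinearMap.map_smul_univ _ _

/-- Geometric form of the determinant solution for the parallel-update TASEP: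
`P_t(X) = (1-v)^(n(X)) det [F̃_{i-j}(x_i - x⁰_j | t)]`. -/
theorem parallel_tasep_geometric_determinant
    (v : ℝ) (hv0 : 0 < v) (hv1 : v < 1) (P : ℕ) (hP : 1 ≤ P)
    (x0 x : Fin P → ℤ) (hx0 : StrictMono x0) (hx : StrictMono x) (t : ℕ) :
    Pt v x0 t x
      = (1 - v) ^ (nPairs x) *
        (Matrix.of fun i j : Fin P => Ftil v ((i : ℤ) - (j : ℤ)) (x i - x0 j) t).det := by
  obtain ⟨n, rfl⟩ := Nat.exists_eq_add_of_le' hP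
  have hv : v ≠ 1 := hv1.ne
  induction t generalizing x with
  | zero => exact (Ftil_initial_det hv x x0 hx0 hx).symm
  | succ t ih =>
    rw [Ftil_det_time_succ hv, det_sum_mul_row (moveWeight v x) fun i b j =>
      Ftil v ((i : ℤ) - (j : ℤ)) (x i - (if b then 1 else 0) - x0 j) t]
    refine Finset.sum_congr rfl fun k _ => ?_
    rw [← Tstep_mul_pow_nPairs v hx]
    split_ifs with hk
    · rw [ih _ hk, mul_assoc]
      rfl
    · rw [zero_mul]

end

end TASEP
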